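/- For every L, p, β ≥ 1 there is a constant c depending only on L, p, β for which the following holds. Let Δ ∈ (0, 1/100] (so that √Δ ≤ 1/10), let h be a measurable function with 𝔼h(X) = 0, 𝔼h(X)² = 1, continuous strictly increasing distribution function F_h, and subexponential tail decay ℙ(|h(X)| ≥ t L) ≤ 2exp(−t) for all t > 0. Then for every φ ∈ ℳ_{p,β} and every realization of the sample X₁,…,X_m satisfying ‖F_{m,h} − F_h‖_{L∞} ≤ √Δ, |∫_{√Δ}^{1−√Δ} φ(F_{m,h}^{−1}(u)) du − 𝔼φ(h(X))| ≤ c √Δ · log^p(e/Δ). -/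

import Mathlib

open MeasureTheory Real Set

noncomputable section

/-- The empirical distribution function of the sample `xs`. -/
def empCDF {m : ℕ} (xs : Fin m → ℝ) (t : ℝ) : ℝ :=
  ((Finset.univ.filter fun i => xs i ≤ t).card : ℝ) / m

/-- The distribution function of `h(X)` where `X ∼ μ`. -/
def cdfOf {𝒳 : Type*} [MeasurableSpace 𝒳] (μ : Measure 𝒳) (h : 𝒳 → ℝ) (t : ℝ) : ℝ :=
  (μ {x | h x ≤ t}).toReal

/-- The L²(μ) distance between two functions. -/
def L2dist {𝒳 : Type*} [MeasurableSpace 𝒳] (μ : Measure 𝒳) (h g : 𝒳 → ℝ) : ℝ :=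
  Real.sqrt (∫ x, (h x - g x) ^ 2 ∂μ)

/-- An admissible sequence of subsets of `H`: `|T 0| = 1` and `|T s| ≤ 2^(2^s)` for `s ≥ 1`. -/
def IsAdmissible {E : Type*} (H : Set E) (T : ℕ → Set E) : Prop :=
  (∀ s, T s ⊆ H) ∧ (∀ s, (T s).Finite) ∧ (∀ s, (T s).Nonempty) ∧
    (T 0).ncard = 1 ∧ ∀ s, 1 ≤ s → (T s).ncard ≤ 2 ^ 2 ^ s

/-- Talagrand's γ₁ functional of `H` with respect to the distance `dist`:
the infimum over admissible sequences of `sup_{h ∈ H} ∑_s 2^s · dist(h, T s)`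
(the sum of the nonnegative series being expressed through its partial sums). -/
def gamma1 {E : Type*} (dist : E → E → ℝ) (H : Set E) : ℝ :=
  sInf { r : ℝ | ∃ T : ℕ → Set E, IsAdmissible H T ∧
    ∀ h ∈ H, ∀ n : ℕ, ∑ s ∈ Finset.range n, (2 : ℝ) ^ s * sInf (dist h '' T s) ≤ r }

/-- Generalized inverse of a distribution function. -/
def quantileFn (F : ℝ → ℝ) (u : ℝ) : ℝ := sInf {t | u ≤ F t}

/-- Assumption (A): every `h ∈ H` has mean zero and variance one; increments have
subexponential tails with constant `L`; and each `h(X)` has a density bounded by `D`. -/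
def AssumptionA {𝒳 : Type*} [MeasurableSpace 𝒳] (μ : Measure 𝒳) (H : Set (𝒳 → ℝ))
    (L D : ℝ) : Prop :=
  (∀ h ∈ H, Measurable h) ∧
  (∀ h ∈ H, ∫ x, h x ∂μ = 0) ∧
  (∀ h ∈ H, ∫ x, (h x) ^ 2 ∂μ = 1) ∧
  (∀ h ∈ insert 0 H, ∀ g ∈ insert 0 H, ∀ t : ℝ, 0 < t →
    μ {x | t * L * L2dist μ h g ≤ |h x - g x|} ≤ ENNReal.ofReal (2 * Real.exp (-t))) ∧
  (∀ h ∈ H, ∃ f : ℝ → ℝ, (∀ t, 0 ≤ f t ∧ f t ≤ D) ∧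
    Measure.map h μ = (volume : Measure ℝ).withDensity fun t => ENNReal.ofReal (f t))

/-- The class `ℳ_{p,β}` of monotone functions with growth `|φ(t)| ≤ β(1 + |t|^p)`. -/
def MemMclass (p β : ℝ) (φ : ℝ → ℝ) : Prop :=
  (Monotone φ ∨ Antitone φ) ∧ ∀ t : ℝ, |φ t| ≤ β * (1 + |t| ^ p)

theorem empCDF_mono {m : ℕ} (xs : Fin m → ℝ) : Monotone (empCDF xs) := by
  intro a b hab
  unfold empCDF
  gcongr

/-- The quantile function of an empirical distribution function is monotone on `(0, 1]`. -/
theorem monotoneOn_sInf_empCDF {m : ℕ} (hm : 0 < m) (xs : Fin m → ℝ) :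
    MonotoneOn (fun u => sInf {t : ℝ | u ≤ empCDF xs t}) (Ioc 0 1) := by
  have hle : ∀ i, |xs i| ≤ ∑ j, |xs j| := fun i =>
    Finset.single_le_sum (f := fun j => |xs j|) (fun j _ => abs_nonneg _) (Finset.mem_univ i)
  intro u hu v hv huv
  refine csInf_le_csInf ⟨-∑ j, |xs j|, fun t ht => ?_⟩ ⟨∑ j, |xs j|, ?_⟩
    fun t ht => huv.trans ht
  · by_contra! hlt
    have h0 : empCDF xs t = 0 := by
      unfold empCDF
      rw [Finset.filter_eq_empty_iff.2]
      · simp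
      · intro i _ hi
        linarith [neg_abs_le (xs i), hle i]
    rw [mem_ofPred_eq, h0] at ht
    exact absurd hu.1 (not_lt.2 ht)
  · have h1 : empCDF xs (∑ j, |xs j|) = 1 := by
      unfold empCDF
      rw [Finset.filter_true_of_mem fun i _ => (le_abs_self _).trans (hle i)]
      simp [hm.ne']
    rw [mem_ofPred_eq, h1]
    exact hv.2

/-- A function dominated by `B + C / √u` near `0` is integrable there, with small integral. -/
theorem integral_near_zero_le {ψ : ℝ → ℝ} {a B C : ℝ} (ha : 0 ≤ a)
    (hψ : AEStronglyMeasurable ψ (volume.restrict (Ioc 0 a)))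
    (hb : ∀ u ∈ Ioc 0 a, |ψ u| ≤ B + C * u ^ (-(1 / 2) : ℝ)) :
    IntervalIntegrable ψ volume 0 a ∧ |∫ u in (0 : ℝ)..a, ψ u| ≤ B * a + 2 * C * a ^ (1 / 2 : ℝ) := by
  have hr : IntervalIntegrable (fun u : ℝ => u ^ (-(1 / 2) : ℝ)) volume 0 a :=
    intervalIntegral.intervalIntegrable_rpow' (by norm_num)
  have hω : IntervalIntegrable (fun u : ℝ => B + C * u ^ (-(1 / 2) : ℝ)) volume 0 a :=
    intervalIntegrable_const.add (hr.const_mul C)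
  refine ⟨?_, ?_⟩
  · rw [intervalIntegrable_iff_integrableOn_Ioc_of_le ha] at hω ⊢
    refine Integrable.mono' hω hψ ?_
    filter_upwards [ae_restrict_mem measurableSet_Ioc] with u hu using hb u hu
  · refine (intervalIntegral.norm_integral_le_of_norm_le ha
      (Filter.Eventually.of_forall fun u hu => (norm_eq_abs _).trans_le (hb u hu)) hω).trans_eq ?_
    rw [intervalIntegral.integral_add intervalIntegrable_const (hr.const_mul C),
      intervalIntegral.integral_const_mul, integral_rpow (Or.inl (by norm_num))]
    norm_num
    ring

/-- If `g` lies between two shifts by `s` of a monotone function `ψ`, its integral over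
`[s, 1 - s]` differs from that of `ψ` over `[0, 1]` by at most the tails of `ψ`. -/
theorem abs_integral_sub_le_of_shift {ψ g : ℝ → ℝ} {s M : ℝ} (hs : 0 ≤ s) (hs' : s ≤ 1 / 2)
    (hψ : IntervalIntegrable ψ volume 0 1)
    (hg : IntervalIntegrable g volume s (1 - s))
    (hlo : ∀ u ∈ Ioo s (1 - s), ψ (u - s) ≤ g u) (hup : ∀ u ∈ Ioo s (1 - s), g u ≤ ψ (u + s))
    (hM₀ : |∫ u in (0 : ℝ)..(2 * s), ψ u| ≤ M) (hM₁ : |∫ u in (1 - 2 * s)..1, ψ u| ≤ M) :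
    |(∫ u in s..(1 - s), g u) - ∫ u in (0 : ℝ)..1, ψ u| ≤ M := by
  have hsub : ∀ a b, a ∈ Icc (0 : ℝ) 1 → b ∈ Icc (0 : ℝ) 1 → IntervalIntegrable ψ volume a b := by
    intro a b ha hb
    refine hψ.mono_set ?_
    rw [uIcc_of_le zero_le_one]
    exact (convex_Icc 0 1).ordConnected.uIcc_subset ha hb
  have m0 : (0 : ℝ) ∈ Icc (0 : ℝ) 1 := by simp
  have m1 : (1 : ℝ) ∈ Icc (0 : ℝ) 1 := by simp
  have ms : 2 * s ∈ Icc (0 : ℝ) 1 := ⟨by linarith, by linarith⟩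
  have mt : 1 - 2 * s ∈ Icc (0 : ℝ) 1 := ⟨by linarith, by linarith⟩
  have e1 := intervalIntegral.integral_add_adjacent_intervals (hsub _ _ m0 ms) (hsub _ _ ms m1)
  have e2 := intervalIntegral.integral_add_adjacent_intervals (hsub _ _ m0 mt) (hsub _ _ mt m1)
  have i1 : IntervalIntegrable (fun u => ψ (u - s)) volume s (1 - s) := by
    have := (hsub _ _ m0 mt).comp_sub_right s
    convert this using 1 <;> ring
  have i2 : IntervalIntegrable (fun u => ψ (u + s)) volume s (1 - s) := by
    have := (hsub _ _ ms m1).comp_add_right s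
    convert this using 1; ring
  have l1 := intervalIntegral.integral_mono_on_of_le_Ioo (by linarith : s ≤ 1 - s) i1 hg hlo
  have l2 := intervalIntegral.integral_mono_on_of_le_Ioo (by linarith : s ≤ 1 - s) hg i2 hup
  rw [intervalIntegral.integral_comp_sub_right (fun u => ψ u)] at l1
  rw [intervalIntegral.integral_comp_add_right (fun u => ψ u)] at l2
  have r1 : s - s = 0 := by ring
  have r2 : 1 - s - s = 1 - 2 * s := by ring
  have r3 : s + s = 2 * s := by ring
  have r4 : 1 - s + s = 1 := by ring
  rw [r1, r2] at l1
  rw [r3, r4] at l2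
  rw [abs_le] at *
  constructor <;> linarith [hM₀.1, hM₀.2, hM₁.1, hM₁.2]

theorem one_add_log_rpow_le {L p A s u : ℝ} (hL : 1 ≤ L) (hp : 1 ≤ p) (hA : 1 ≤ A)
    (hs : 0 < s) (hsA : -log s ≤ A) (hu : 0 < u) (hu2 : u ≤ 2) :
    1 + (L * log (2 / u)) ^ p ≤
      2 * (4 * p * L) ^ p * A ^ p +
        2 * (4 * p * L) ^ p * (2 * s) ^ (1 / 2 : ℝ) * u ^ (-(1 / 2) : ℝ) := by
  have hp0 : 0 < p := by linarith
  set y : ℝ := (2 * s / u) ^ (1 / (2 * p)) with hy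
  have hy0 : 0 < y := by positivity
  have hlog : log (2 / u) ≤ A + 2 * p * y := by
    have h1 : log (2 / u) = -log s + log (2 * s / u) := by
      rw [log_div two_ne_zero hu.ne', log_div (by positivity) hu.ne',
        log_mul two_ne_zero hs.ne']
      ring
    have h2 := Real.log_le_rpow_div (x := 2 * s / u) (by positivity)
      (show 0 < 1 / (2 * p) by positivity)
    rw [← hy, div_div_eq_mul_div, div_one] at h2
    linarith
  have hl0 : 0 ≤ log (2 / u) := log_nonneg (by rw [le_div_iff₀ hu]; linarith)
  have hyp : y ^ p = (2 * s) ^ (1 / 2 : ℝ) * u ^ (-(1 / 2) : ℝ) := by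
    rw [hy, ← rpow_mul (by positivity), show 1 / (2 * p) * p = 1 / 2 by field_simp,
      div_rpow (by positivity) hu.le, rpow_neg hu.le, div_eq_mul_inv]
  have hmax : max A y ^ p ≤ A ^ p + y ^ p := by
    have := rpow_nonneg (zero_le_one.trans hA) p
    have := rpow_nonneg hy0.le p
    rcases max_cases A y with h | h <;> rw [h.1] <;> linarith
  have hmain : (L * log (2 / u)) ^ p ≤ (4 * p * L) ^ p * (A ^ p + y ^ p) := by
    calc (L * log (2 / u)) ^ p ≤ (4 * p * L * max A y) ^ p := by
          refine rpow_le_rpow (by positivity) ?_ hp0.le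
          have h3 : log (2 / u) ≤ 4 * p * max A y := by
            have := le_max_left A y
            have := le_max_right A y
            nlinarith
          calc L * log (2 / u) ≤ L * (4 * p * max A y) := by gcongr
            _ = _ := by ring
      _ = (4 * p * L) ^ p * max A y ^ p := mul_rpow (by positivity) (by positivity)
      _ ≤ _ := by gcongr
  have h1 : 1 ≤ (4 * p * L) ^ p := one_le_rpow (by nlinarith) hp0.le
  have h2 : 1 ≤ A ^ p := one_le_rpow hA hp0.le
  have h3 : 0 < y ^ p := by positivity
  rw [mul_assoc _ ((2 * s) ^ (1 / 2 : ℝ)), ← hyp]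
  nlinarith [mul_nonneg (sub_nonneg.2 h1) (sub_nonneg.2 h2),
    mul_nonneg (zero_le_one.trans h1) h3.le]

section Quantile

variable {𝒳 : Type*} [MeasurableSpace 𝒳] {μ : Measure 𝒳} {h : 𝒳 → ℝ}

theorem cdfOf_neg_le {L t : ℝ} (ht : 0 < t)
    (htail : ∀ t : ℝ, 0 < t → μ {x | t * L ≤ |h x|} ≤ ENNReal.ofReal (2 * Real.exp (-t))) :
    cdfOf μ h (-(t * L)) ≤ 2 * Real.exp (-t) := by
  refine ENNReal.toReal_le_of_le_ofReal (by positivity) ((measure_mono ?_).trans (htail t ht))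
  intro x hx
  rw [mem_ofPred_eq] at hx ⊢
  linarith [neg_abs_le (h x)]

theorem le_of_cdfOf_eq (hmono : StrictMono (cdfOf μ h)) {L u y : ℝ}
    (htail : ∀ t : ℝ, 0 < t → μ {x | t * L ≤ |h x|} ≤ ENNReal.ofReal (2 * Real.exp (-t)))
    (hu : u ∈ Ioo 0 1) (hy : cdfOf μ h y = u) : -(L * log (2 / u)) ≤ y := by
  have hpos : 0 < 2 / u := div_pos two_pos hu.1
  have ht : 0 < log (2 / u) := log_pos (by rw [lt_div_iff₀ hu.1]; linarith [hu.2])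
  have h1 := cdfOf_neg_le ht htail
  rw [Real.exp_neg, exp_log hpos, inv_div, mul_div_cancel₀ _ two_ne_zero, ← hy,
    hmono.le_iff_le, hy] at h1
  linarith

theorem sInf_empCDF_bounds (hmono : StrictMono (cdfOf μ h)) {m : ℕ} {xs : Fin m → ℝ} {s u a b : ℝ}
    (hdev : ∀ t : ℝ, |empCDF xs t - cdfOf μ h t| ≤ s)
    (ha : cdfOf μ h a = u - s) (hb : cdfOf μ h b = u + s) :
    a ≤ sInf {t : ℝ | u ≤ empCDF xs t} ∧ sInf {t : ℝ | u ≤ empCDF xs t} ≤ b := by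
  have hlow : ∀ t ∈ {t : ℝ | u ≤ empCDF xs t}, a ≤ t := by
    intro t ht
    rw [mem_ofPred_eq] at ht
    rw [← hmono.le_iff_le, ha]
    linarith [(abs_le.1 (hdev t)).2]
  have hbmem : b ∈ {t : ℝ | u ≤ empCDF xs t} := by
    rw [mem_ofPred_eq]
    linarith [(abs_le.1 (hdev b)).1]
  exact ⟨le_csInf ⟨b, hbmem⟩ hlow, csInf_le ⟨a, hlow⟩ hbmem⟩

variable [IsProbabilityMeasure μ]

theorem cdfOf_eq_cdf_map (hh : Measurable h) :
    cdfOf μ h = ProbabilityTheory.cdf (μ.map h) := by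
  have := Measure.isProbabilityMeasure_map (μ := μ) hh.aemeasurable
  ext t
  rw [ProbabilityTheory.cdf_eq_real, measureReal_def, Measure.map_apply hh measurableSet_Iic]
  rfl

theorem cdfOf_mem_Ioo (hh : Measurable h) (hmono : StrictMono (cdfOf μ h)) (t : ℝ) :
    cdfOf μ h t ∈ Ioo 0 1 := by
  have h0 : 0 ≤ cdfOf μ h (t - 1) := ENNReal.toReal_nonneg
  have h1 : cdfOf μ h (t + 1) ≤ 1 := by
    rw [cdfOf_eq_cdf_map hh]; exact ProbabilityTheory.cdf_le_one _ _
  exact ⟨h0.trans_lt (hmono (by linarith)), (hmono (by linarith)).trans_le h1⟩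

theorem exists_cdfOf_eq (hh : Measurable h) (hcont : Continuous (cdfOf μ h)) {u : ℝ}
    (hu : u ∈ Ioo 0 1) : ∃ t, cdfOf μ h t = u := by
  have h0 := ProbabilityTheory.tendsto_cdf_atBot (μ.map h)
  have h1 := ProbabilityTheory.tendsto_cdf_atTop (μ.map h)
  rw [← cdfOf_eq_cdf_map hh] at h0 h1
  obtain ⟨a, ha⟩ := (h0.eventually_lt_const hu.1).exists
  obtain ⟨b, hb⟩ := (h1.eventually_const_lt hu.2).exists
  exact mem_range_of_exists_le_of_exists_ge hcont ⟨a, ha.le⟩ ⟨b, hb.le⟩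

/-- The probability integral transform: `F_h(h(X))` is uniformly distributed. -/
theorem map_cdfOf_comp (hh : Measurable h) (hcont : Continuous (cdfOf μ h))
    (hmono : StrictMono (cdfOf μ h)) :
    μ.map (fun x => cdfOf μ h (h x)) = volume.restrict (Ioo (0 : ℝ) 1) := by
  have hmeas : Measurable fun x => cdfOf μ h (h x) := hcont.measurable.comp hh
  have := Measure.isProbabilityMeasure_map (μ := μ) hmeas.aemeasurable
  refine Measure.ext_of_Iic _ _ fun u => ?_
  rw [Measure.map_apply hmeas measurableSet_Iic, Measure.restrict_apply measurableSet_Iic]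
  rcases le_or_gt u 0 with h0 | h0
  · have e1 : (fun x => cdfOf μ h (h x)) ⁻¹' Iic u = ∅ := by
      ext x
      simpa using h0.trans_lt (cdfOf_mem_Ioo hh hmono (h x)).1
    have e2 : Iic u ∩ Ioo (0 : ℝ) 1 = ∅ := by
      ext x
      simp only [mem_inter_iff, mem_Iic, mem_Ioo, mem_empty_iff_false, iff_false]
      intro hx
      linarith [hx.1, hx.2.1]
    rw [e1, e2, measure_empty, measure_empty]
  rcases le_or_gt 1 u with h1 | h1
  · have e1 : (fun x => cdfOf μ h (h x)) ⁻¹' Iic u = univ := by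
      ext x
      simpa using (cdfOf_mem_Ioo hh hmono (h x)).2.le.trans h1
    have e2 : Iic u ∩ Ioo (0 : ℝ) 1 = Ioo 0 1 :=
      inter_eq_right.2 fun x hx => hx.2.le.trans h1
    rw [e1, e2, measure_univ, Real.volume_Ioo]
    simp
  · obtain ⟨t, ht⟩ := exists_cdfOf_eq hh hcont ⟨h0, h1⟩
    have e1 : (fun x => cdfOf μ h (h x)) ⁻¹' Iic u = {x | h x ≤ t} := by
      ext x
      rw [mem_preimage, mem_Iic, ← ht, hmono.le_iff_le]
      rfl
    have e2 : Iic u ∩ Ioo (0 : ℝ) 1 = Ioc 0 u := by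
      ext x
      simp only [mem_inter_iff, mem_Iic, mem_Ioo, mem_Ioc]
      exact ⟨fun hx => ⟨hx.2.1, hx.1⟩, fun hx => ⟨hx.2, hx.1, hx.2.trans_lt h1⟩⟩
    rw [e1, e2, Real.volume_Ioc, sub_zero, ← ht, cdfOf,
      ENNReal.ofReal_toReal (measure_ne_top _ _)]

theorem one_sub_cdfOf_le (hh : Measurable h) {L t : ℝ} (ht : 0 < t)
    (htail : ∀ t : ℝ, 0 < t → μ {x | t * L ≤ |h x|} ≤ ENNReal.ofReal (2 * Real.exp (-t))) :
    1 - cdfOf μ h (t * L) ≤ 2 * Real.exp (-t) := by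
  have hc : 1 - cdfOf μ h (t * L) = μ.real {x | h x ≤ t * L}ᶜ := by
    rw [probReal_compl_eq_one_sub (measurableSet_le hh measurable_const)]
    rfl
  rw [hc]
  refine ENNReal.toReal_le_of_le_ofReal (by positivity) ((measure_mono ?_).trans (htail t ht))
  intro x hx
  simp only [mem_compl_iff, mem_ofPred_eq, not_le] at hx ⊢
  linarith [le_abs_self (h x)]

theorem le_of_cdfOf_eq' (hh : Measurable h) (hmono : StrictMono (cdfOf μ h)) {L u y : ℝ}
    (htail : ∀ t : ℝ, 0 < t → μ {x | t * L ≤ |h x|} ≤ ENNReal.ofReal (2 * Real.exp (-t)))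
    (hu : u ∈ Ioo 0 1) (hy : cdfOf μ h y = u) : y ≤ L * log (2 / (1 - u)) := by
  have hu1 : 0 < 1 - u := sub_pos.2 hu.2
  have hpos : 0 < 2 / (1 - u) := div_pos two_pos hu1
  have ht : 0 < log (2 / (1 - u)) := log_pos (by rw [lt_div_iff₀ hu1]; linarith [hu.1])
  have h1 := one_sub_cdfOf_le hh ht htail
  rw [Real.exp_neg, exp_log hpos, inv_div, mul_div_cancel₀ _ two_ne_zero, sub_le_sub_iff_left,
    ← hy, hmono.le_iff_le, hy] at h1
  linarith

theorem abs_le_of_cdfOf_eq (hh : Measurable h) (hmono : StrictMono (cdfOf μ h)) {L u v y : ℝ}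
    (hL : 0 ≤ L)
    (htail : ∀ t : ℝ, 0 < t → μ {x | t * L ≤ |h x|} ≤ ENNReal.ofReal (2 * Real.exp (-t)))
    (hv : 0 < v) (hvu : v ≤ u) (hvu' : v ≤ 1 - u) (hy : cdfOf μ h y = u) :
    |y| ≤ L * log (2 / v) := by
  have hu : u ∈ Ioo 0 1 := ⟨by linarith, by linarith⟩
  have h1 := le_of_cdfOf_eq hmono htail hu hy
  have h2 := le_of_cdfOf_eq' hh hmono htail hu hy
  have hu0 : 0 < u := hu.1
  have hu1 : 0 < 1 - u := sub_pos.2 hu.2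
  have l1 : L * log (2 / u) ≤ L * log (2 / v) := by gcongr
  have l2 : L * log (2 / (1 - u)) ≤ L * log (2 / v) := by gcongr
  rw [abs_le]
  constructor <;> linarith

theorem trimmed_estimate_of_monotone {L p β : ℝ} (hL : 1 ≤ L) (hp : 1 ≤ p) (hβ : 1 ≤ β)
    (hh : Measurable h) (hcont : Continuous (cdfOf μ h)) (hmono : StrictMono (cdfOf μ h))
    (htail : ∀ t : ℝ, 0 < t → μ {x | t * L ≤ |h x|} ≤ ENNReal.ofReal (2 * Real.exp (-t)))
    {Δ : ℝ} (hΔ : 0 < Δ) (hΔ' : Δ ≤ 1 / 100) {m : ℕ} (hm : 0 < m) {xs : Fin m → ℝ}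
    (hdev : ∀ t : ℝ, |empCDF xs t - cdfOf μ h t| ≤ Real.sqrt Δ)
    {φ : ℝ → ℝ} (hφ : Monotone φ) (hgrowth : ∀ t : ℝ, |φ t| ≤ β * (1 + |t| ^ p)) :
    |(∫ u in Real.sqrt Δ..(1 - Real.sqrt Δ), φ (sInf {t : ℝ | u ≤ empCDF xs t})) -
        ∫ x, φ (h x) ∂μ| ≤
      12 * β * (4 * p * L) ^ p * Real.sqrt Δ * Real.log (Real.exp 1 / Δ) ^ p := by
  set s := √Δ with hs
  have hs0 : 0 < s := Real.sqrt_pos.2 hΔ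
  have hs1 : s ≤ 1 / 10 := by
    rw [hs, Real.sqrt_le_left (by norm_num)]
    norm_num
    linarith
  set A := log (Real.exp 1 / Δ) with hA
  have hAeq : A = 1 - log Δ := by rw [hA, log_div (Real.exp_pos 1).ne' hΔ.ne', log_exp]
  have hlogΔ : log Δ ≤ 0 := log_nonpos hΔ.le (by linarith)
  have hA1 : 1 ≤ A := by linarith
  have hsA : -log s ≤ A := by rw [hs, log_sqrt hΔ.le]; linarith
  set F := cdfOf μ h with hF
  set G := Function.invFun F with hG
  have hFG : ∀ u ∈ Ioo (0 : ℝ) 1, F (G u) = u := fun u hu =>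
    Function.invFun_eq (exists_cdfOf_eq hh hcont hu)
  have hGF : ∀ t, G (F t) = t := Function.leftInverse_invFun hmono.injective
  have hGmono : MonotoneOn G (Ioo 0 1) := fun u hu v hv huv => by
    rwa [← hmono.le_iff_le, hFG u hu, hFG v hv]
  set ψ : ℝ → ℝ := fun u => φ (G u) with hψ
  have hψmono : MonotoneOn ψ (Ioo 0 1) := hφ.comp_monotoneOn hGmono
  have hψmeas : AEMeasurable ψ (volume.restrict (Ioo 0 1)) :=
    aemeasurable_restrict_of_monotoneOn measurableSet_Ioo hψmono
  have hmean : ∫ x, φ (h x) ∂μ = ∫ u in (0 : ℝ)..1, ψ u := by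
    have hmeas : Measurable fun x => F (h x) := hcont.measurable.comp hh
    rw [intervalIntegral.integral_of_le zero_le_one, integral_Ioc_eq_integral_Ioo,
      ← map_cdfOf_comp hh hcont hmono, integral_map hmeas.aemeasurable]
    · simp only [hψ, hGF]
    · rw [map_cdfOf_comp hh hcont hmono]
      exact hψmeas.aestronglyMeasurable
  set K := 2 * (4 * p * L) ^ p with hK
  have hK0 : 0 < K := by positivity
  have hψb : ∀ u v : ℝ, 0 < v → v ≤ u → v ≤ 1 - u →
      |ψ u| ≤ β * K * A ^ p + β * K * (2 * s) ^ (1 / 2 : ℝ) * v ^ (-(1 / 2) : ℝ) := by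
    intro u v hv hvu hvu'
    have hGu := abs_le_of_cdfOf_eq hh hmono (by linarith) htail hv hvu hvu'
      (hFG u ⟨by linarith, by linarith⟩)
    calc |ψ u| ≤ β * (1 + |G u| ^ p) := hgrowth _
      _ ≤ β * (1 + (L * log (2 / v)) ^ p) := by gcongr
      _ ≤ β * (K * A ^ p + K * (2 * s) ^ (1 / 2 : ℝ) * v ^ (-(1 / 2) : ℝ)) := by
          exact mul_le_mul_of_nonneg_left
            (one_add_log_rpow_le hL hp hA1 hs0 hsA hv (by linarith)) (by linarith)
      _ = _ := by ring
  have hleft : ∀ a : ℝ, 0 ≤ a → a ≤ 1 / 2 → IntervalIntegrable ψ volume 0 a ∧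
      |∫ u in (0 : ℝ)..a, ψ u| ≤
        β * K * A ^ p * a + 2 * (β * K * (2 * s) ^ (1 / 2 : ℝ)) * a ^ (1 / 2 : ℝ) := by
    intro a ha ha'
    refine integral_near_zero_le ha ?_ fun u hu => hψb u u hu.1 le_rfl (by linarith [hu.2])
    exact hψmeas.aestronglyMeasurable.mono_measure (Measure.restrict_mono
      (fun u (hu : u ∈ Ioc 0 a) => show u ∈ Ioo 0 1 from ⟨hu.1, by linarith [hu.2]⟩) le_rfl)
  have hψmeas' : AEMeasurable (fun u => ψ (1 - u)) (volume.restrict (Ioo 0 1)) := by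
    refine aemeasurable_restrict_of_antitoneOn measurableSet_Ioo fun u hu v hv huv => ?_
    exact hψmono ⟨by linarith [hv.2], by linarith [hv.1]⟩
      ⟨by linarith [hu.2], by linarith [hu.1]⟩ (by linarith)
  have hright : ∀ a : ℝ, 0 ≤ a → a ≤ 1 / 2 → IntervalIntegrable (fun u => ψ (1 - u)) volume 0 a ∧
      |∫ u in (0 : ℝ)..a, ψ (1 - u)| ≤
        β * K * A ^ p * a + 2 * (β * K * (2 * s) ^ (1 / 2 : ℝ)) * a ^ (1 / 2 : ℝ) := by
    intro a ha ha'
    refine integral_near_zero_le ha ?_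
      fun u hu => hψb (1 - u) u hu.1 (by linarith [hu.2]) (by linarith)
    exact hψmeas'.aestronglyMeasurable.mono_measure (Measure.restrict_mono
      (fun u (hu : u ∈ Ioc 0 a) => show u ∈ Ioo 0 1 from ⟨hu.1, by linarith [hu.2]⟩) le_rfl)
  have hψint : IntervalIntegrable ψ volume 0 1 := by
    have h1 := (hleft (1 / 2) (by norm_num) le_rfl).1
    have h2 := ((hright (1 / 2) (by norm_num) le_rfl).1.comp_sub_left 1).symm
    norm_num at h1 h2
    exact h1.trans h2
  have hbound : β * K * A ^ p * (2 * s) +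
      2 * (β * K * (2 * s) ^ (1 / 2 : ℝ)) * (2 * s) ^ (1 / 2 : ℝ) ≤
        12 * β * (4 * p * L) ^ p * s * A ^ p := by
    have hsq : (2 * s) ^ (1 / 2 : ℝ) * (2 * s) ^ (1 / 2 : ℝ) = 2 * s := by
      rw [← rpow_add (by positivity)]; norm_num
    have hAp : 1 ≤ A ^ p := one_le_rpow hA1 (by linarith)
    calc β * K * A ^ p * (2 * s) +
          2 * (β * K * (2 * s) ^ (1 / 2 : ℝ)) * (2 * s) ^ (1 / 2 : ℝ)
        = β * K * A ^ p * (2 * s) +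
          2 * (β * K) * ((2 * s) ^ (1 / 2 : ℝ) * (2 * s) ^ (1 / 2 : ℝ)) * 1 := by ring
      _ ≤ β * K * A ^ p * (2 * s) + 2 * (β * K) * (2 * s) * A ^ p := by rw [hsq]; gcongr
      _ = 12 * β * (4 * p * L) ^ p * s * A ^ p := by rw [hK]; ring
  have hshift : ∀ u ∈ Ioo s (1 - s), G (u - s) ≤ sInf {t : ℝ | u ≤ empCDF xs t} ∧
      sInf {t : ℝ | u ≤ empCDF xs t} ≤ G (u + s) := fun u hu =>
    sInf_empCDF_bounds hmono hdev (hFG _ ⟨by linarith [hu.1], by linarith [hu.2]⟩)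
      (hFG _ ⟨by linarith [hu.1], by linarith [hu.2]⟩)
  rw [hmean]
  refine abs_integral_sub_le_of_shift hs0.le (by linarith) hψint ?_
    (fun u hu => hφ (hshift u hu).1) (fun u hu => hφ (hshift u hu).2)
    ((hleft (2 * s) (by linarith) (by linarith)).2.trans hbound) ?_
  · refine (hφ.comp_monotoneOn ((monotoneOn_sInf_empCDF hm xs).mono ?_)).intervalIntegrable
    rw [uIcc_of_le (by linarith)]
    exact fun u hu => ⟨by linarith [hu.1], by linarith [hu.2]⟩
  · have h2 := (hright (2 * s) (by linarith) (by linarith)).2.trans hbound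
    rwa [intervalIntegral.integral_comp_sub_left (fun u => ψ u), sub_zero] at h2

end Quantile

/-- **Lemma 5.3**: on the event `‖F_{m,h} − F_h‖_∞ ≤ √Δ`, for every `φ ∈ ℳ_{p,β}`,
`|∫_{√Δ}^{1−√Δ} φ(F_{m,h}⁻¹(u)) du − 𝔼φ(h(X))| ≤ c √Δ log^p(e/Δ)`. -/
theorem trimmed_estimate (L p β : ℝ) (hL : 1 ≤ L) (hp : 1 ≤ p) (hβ : 1 ≤ β) :
    ∃ c : ℝ, 0 < c ∧
      ∀ (𝒳 : Type) [MeasurableSpace 𝒳] (μ : Measure 𝒳) [IsProbabilityMeasure μ]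
        (h : 𝒳 → ℝ), Measurable h →
        (∫ x, h x ∂μ) = 0 → (∫ x, (h x) ^ 2 ∂μ) = 1 →
        Continuous (cdfOf μ h) → StrictMono (cdfOf μ h) →
        (∀ t : ℝ, 0 < t → μ {x | t * L ≤ |h x|} ≤ ENNReal.ofReal (2 * Real.exp (-t))) →
        ∀ (Δ : ℝ), 0 < Δ → Δ ≤ 1 / 100 →
        ∀ (m : ℕ), 0 < m → ∀ xs : Fin m → ℝ,
        (∀ t : ℝ, |empCDF xs t - cdfOf μ h t| ≤ Real.sqrt Δ) →
        ∀ φ : ℝ → ℝ, MemMclass p β φ →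
        |(∫ u in Real.sqrt Δ..(1 - Real.sqrt Δ), φ (sInf {t : ℝ | u ≤ empCDF xs t})) -
            ∫ x, φ (h x) ∂μ| ≤
          c * Real.sqrt Δ * Real.log (Real.exp 1 / Δ) ^ p := by
  refine ⟨12 * β * (4 * p * L) ^ p, by positivity, ?_⟩
  intro 𝒳 _ μ _ h hh _ _ hcont hmono htail Δ hΔ hΔ' m hm xs hdev φ ⟨hφ, hgrowth⟩
  rcases hφ with hφ | hφ
  · exact trimmed_estimate_of_monotone hL hp hβ hh hcont hmono htail hΔ hΔ' hm hdev hφ hgrowth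
  · have key := trimmed_estimate_of_monotone hL hp hβ hh hcont hmono htail hΔ hΔ' hm hdev hφ.neg
      (fun t => by simpa using hgrowth t)
    simp only [intervalIntegral.integral_neg, integral_neg] at key
    rwa [← neg_sub', abs_neg] at key
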